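/- (Single-particle VSD minimizes the KL objective) For every θ ∈ ℝᴺ, the Variational Score Distillation update equals the gradient of the KL objective: −E_{t~U[0,T], c~p_c, ε~N(0,I_D)}[ ω(t) (∂g(θ,c)/∂θ)ᵀ ( σ_t ∇log p_t(x_t) − σ_t ∇log q_t^θ(x_t | c) ) ] = ∇_θ J_KL(θ), where x_t = α_t g(θ,c) + σ_t ε; equivalently, the camera-conditioned score term has zero expectation: E_{t~U[0,T], c~p_c, ε~N(0,I_D)}[ ω(t) σ_t (∂g(θ,c)/∂θ)ᵀ ∇log q_t^θ(x_t | c) ] = 0. -/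

import Mathlib

open MeasureTheory Real

noncomputable section

/-- The isotropic Gaussian density `N(m, σ² I_D)` on `EuclideanSpace ℝ (Fin D)`. -/
def gaussPDF {D : ℕ} (m : EuclideanSpace ℝ (Fin D)) (σ : ℝ)
    (x : EuclideanSpace ℝ (Fin D)) : ℝ :=
  (2 * π * σ ^ 2) ^ (-(D : ℝ) / 2) * exp (-‖x - m‖ ^ 2 / (2 * σ ^ 2))

/-- `KL(q ‖ p) = ∫ q log (q / p)` (w.r.t. Lebesgue measure). -/
def klDivFn {D : ℕ} (q p : EuclideanSpace ℝ (Fin D) → ℝ) : ℝ :=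
  ∫ x, q x * log (q x / p x)

variable {N D : ℕ} {C : Type*} [MeasurableSpace C]

/-- The vanilla KL objective
`J_KL(θ) = E_{t ~ U[0,T], c ~ p_c}[Ω(t) KL(q_t^θ(·|c) ‖ p_t)]` with `Ω(t) = ω(t)σ_t/α_t`,
where `q_t^θ(·|c) = N(α_t g(θ,c), σ_t² I_D)`. -/
def Jkl (pc : Measure C) (T : ℝ) (a s w : ℝ → ℝ)
    (g : EuclideanSpace ℝ (Fin N) → C → EuclideanSpace ℝ (Fin D))
    (p : ℝ → EuclideanSpace ℝ (Fin D) → ℝ)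
    (θ : EuclideanSpace ℝ (Fin N)) : ℝ :=
  (1 / T) * ∫ t in Set.Icc (0 : ℝ) T,
    (∫ c, w t * s t / a t * klDivFn (gaussPDF (a t • g θ c) (s t)) (p t) ∂pc)

/-- Chain rule for gradients: the gradient of a composition is the adjoint of the derivative of
the inner map applied to the gradient of the outer function. -/
theorem HasGradientAt.comp_hasFDerivAt {E F : Type*} [NormedAddCommGroup E]
    [InnerProductSpace ℝ E] [CompleteSpace E] [NormedAddCommGroup F] [InnerProductSpace ℝ F]
    [CompleteSpace F] {f : F → ℝ} {h : E → F} {A : E →L[ℝ] F} {v : F} {x : E}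
    (hf : HasGradientAt f v (h x)) (hh : HasFDerivAt h A x) :
    HasGradientAt (fun y => f (h y)) (ContinuousLinearMap.adjoint A v) x := by
  rw [hasGradientAt_iff_hasFDerivAt] at hf ⊢
  refine (hf.comp x hh).congr_fderiv ?_
  ext y
  simp [ContinuousLinearMap.adjoint_inner_left]

theorem log_gaussPDF {D : ℕ} (m : EuclideanSpace ℝ (Fin D)) {σ : ℝ} (hσ : σ ≠ 0)
    (x : EuclideanSpace ℝ (Fin D)) :
    log (gaussPDF m σ x) =
      log ((2 * π * σ ^ 2) ^ (-(D : ℝ) / 2)) + -‖x - m‖ ^ 2 / (2 * σ ^ 2) := by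
  have hK : 0 < (2 * π * σ ^ 2) ^ (-(D : ℝ) / 2) := by positivity
  rw [gaussPDF, log_mul hK.ne' (exp_ne_zero _), log_exp]

theorem gaussPDF_zero_neg {D : ℕ} (σ : ℝ) (x : EuclideanSpace ℝ (Fin D)) :
    gaussPDF 0 σ (-x) = gaussPDF 0 σ x := by
  simp [gaussPDF]

/-- The score of an isotropic Gaussian. -/
theorem hasGradientAt_log_gaussPDF {D : ℕ} (m : EuclideanSpace ℝ (Fin D)) {σ : ℝ} (hσ : σ ≠ 0)
    (x : EuclideanSpace ℝ (Fin D)) :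
    HasGradientAt (fun x => log (gaussPDF m σ x)) (-(σ ^ 2)⁻¹ • (x - m)) x := by
  simp only [log_gaussPDF m hσ]
  rw [hasGradientAt_iff_hasFDerivAt]
  have h := ((((hasFDerivAt_id x).sub_const m).norm_sq).const_mul (-(2 * σ ^ 2)⁻¹)).const_add
    (log ((2 * π * σ ^ 2) ^ (-(D : ℝ) / 2)))
  refine (h.congr_fderiv ?_).congr_of_eventuallyEq (.of_forall fun y => ?_)
  · ext y
    simp
    ring
  · simp
    ring

theorem gradient_log_gaussPDF_add_smul {D : ℕ} (m : EuclideanSpace ℝ (Fin D)) {σ : ℝ}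
    (hσ : σ ≠ 0) (ε : EuclideanSpace ℝ (Fin D)) :
    gradient (fun x => log (gaussPDF m σ x)) (m + σ • ε) = -σ⁻¹ • ε := by
  rw [(hasGradientAt_log_gaussPDF m hσ _).gradient, add_sub_cancel_left, smul_smul]
  congr 1
  field_simp

/-- The linear image of the Gaussian score has zero expectation under the Gaussian. -/
theorem integral_gaussPDF_smul_gradient_log_gaussPDF {D : ℕ} {E : Type*} [NormedAddCommGroup E]
    [NormedSpace ℝ E] (L : EuclideanSpace ℝ (Fin D) →L[ℝ] E) (m : EuclideanSpace ℝ (Fin D))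
    {σ : ℝ} (hσ : σ ≠ 0) (k : ℝ) :
    ∫ ε, (gaussPDF 0 1 ε * k) • L (gradient (fun x => log (gaussPDF m σ x)) (m + σ • ε)) = 0 := by
  simp only [gradient_log_gaussPDF_add_smul m hσ]
  have : IsAddTorsionFree E := .of_isTorsionFree ℝ E
  rw [← self_eq_neg, ← integral_neg, ← integral_neg_eq_self]
  simp [gaussPDF_zero_neg]

/-- Along a reparametrized sample, only the `log p` term of the log-ratio depends on the
parameter. -/
theorem gradient_log_gaussPDF_sub_log {D : ℕ} {E : Type*} [NormedAddCommGroup E]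
    [InnerProductSpace ℝ E] [CompleteSpace E] {h : E → EuclideanSpace ℝ (Fin D)} {θ : E}
    (hh : DifferentiableAt ℝ h θ) {a s : ℝ} (ha : a ≠ 0) (hs : s ≠ 0) (w : ℝ)
    (ε : EuclideanSpace ℝ (Fin D)) {f : EuclideanSpace ℝ (Fin D) → ℝ}
    (hf : DifferentiableAt ℝ (fun x => log (f x)) (a • h θ + s • ε)) :
    gradient (fun θ' => w * s / a *
        (log (gaussPDF (a • h θ') s (a • h θ' + s • ε)) - log (f (a • h θ' + s • ε)))) θ =
      -(w • ContinuousLinearMap.adjoint (fderiv ℝ h θ)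
        (s • gradient (fun x => log (f x)) (a • h θ + s • ε))) := by
  have hc := HasGradientAt.comp_hasFDerivAt (h := fun θ' => a • h θ' + s • ε) hf.hasGradientAt
    ((hh.hasFDerivAt.const_smul a).add_const (s • ε))
  rw [hasGradientAt_iff_hasFDerivAt] at hc
  simp only [log_gaussPDF _ hs, add_sub_cancel_left]
  refine HasGradientAt.gradient ?_
  rw [hasGradientAt_iff_hasFDerivAt]
  refine ((hc.const_sub _).const_mul (w * s / a)).congr_fderiv ?_
  simp only [map_smulₛₗ, map_neg, smul_apply, smul_neg, smul_smul, conj_trivial,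
    RingHom.id_apply]
  congr 2
  field_simp

/-- **Single-particle VSD minimizes the KL objective.** The Variational Score Distillation
update equals the gradient of the KL objective:
`−E_{t,c,ε}[ ω(t) (∂g(θ,c)/∂θ)ᵀ (σ_t ∇log p_t(x_t) − σ_t ∇log q_t^θ(x_t|c)) ] = ∇_θ J_KL(θ)`
with `x_t = α_t g(θ,c) + σ_t ε` and `q_t^θ(·|c) = N(α_t g(θ,c), σ_t² I_D)`; equivalently, the
camera-conditioned score term has zero expectation:
`E_{t,c,ε}[ ω(t) σ_t (∂g(θ,c)/∂θ)ᵀ ∇log q_t^θ(x_t|c) ] = 0`.  The hypothesis `hDUI` encodes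
reparameterization and differentiation under the integral sign, and the `Integrable`
hypotheses encode the blanket assumption that all the integrals involved are finite. -/
theorem vsd_update_eq_gradient_Jkl
    (pc : Measure C) [IsProbabilityMeasure pc]
    (T : ℝ) (hT : 0 < T) (a s w : ℝ → ℝ)
    (ha : ∀ t ∈ Set.Icc (0 : ℝ) T, 0 < a t)
    (hs : ∀ t ∈ Set.Icc (0 : ℝ) T, 0 < s t)
    (hw : ∀ t ∈ Set.Icc (0 : ℝ) T, 0 < w t)
    (g : EuclideanSpace ℝ (Fin N) → C → EuclideanSpace ℝ (Fin D))
    (hg : ∀ c : C, Differentiable ℝ (fun θ' => g θ' c))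
    (p : ℝ → EuclideanSpace ℝ (Fin D) → ℝ)
    (hp_pos : ∀ t x, 0 < p t x)
    (hp_smooth : ∀ t, ContDiff ℝ (⊤ : ℕ∞) (p t))
    (θ : EuclideanSpace ℝ (Fin N))
    (hDUI : gradient (Jkl pc T a s w g p) θ =
      (1 / T) • ∫ t in Set.Icc (0 : ℝ) T, (∫ c, (∫ ε : EuclideanSpace ℝ (Fin D),
        gaussPDF 0 1 ε •
          gradient (fun θ' => w t * s t / a t *
            (log (gaussPDF (a t • g θ' c) (s t) (a t • g θ' c + s t • ε)) -
              log (p t (a t • g θ' c + s t • ε)))) θ) ∂pc))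
    (hInt_score : ∀ t ∈ Set.Icc (0 : ℝ) T, ∀ c : C,
      Integrable (fun ε : EuclideanSpace ℝ (Fin D) =>
        (gaussPDF 0 1 ε * w t) •
          ContinuousLinearMap.adjoint (fderiv ℝ (fun θ' => g θ' c) θ)
            (s t • gradient (fun x => log (p t x)) (a t • g θ c + s t • ε))))
    (hInt_cond : ∀ t ∈ Set.Icc (0 : ℝ) T, ∀ c : C,
      Integrable (fun ε : EuclideanSpace ℝ (Fin D) =>
        (gaussPDF 0 1 ε * w t) •
          ContinuousLinearMap.adjoint (fderiv ℝ (fun θ' => g θ' c) θ)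
            (s t • gradient (fun x => log (gaussPDF (a t • g θ c) (s t) x))
              (a t • g θ c + s t • ε)))) :
    (-((1 / T) • ∫ t in Set.Icc (0 : ℝ) T, (∫ c, (∫ ε : EuclideanSpace ℝ (Fin D),
        (gaussPDF 0 1 ε * w t) •
          ContinuousLinearMap.adjoint (fderiv ℝ (fun θ' => g θ' c) θ)
            (s t • gradient (fun x => log (p t x)) (a t • g θ c + s t • ε) -
              s t • gradient (fun x => log (gaussPDF (a t • g θ c) (s t) x))
                (a t • g θ c + s t • ε))) ∂pc)) =
      gradient (Jkl pc T a s w g p) θ) ∧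
    ((1 / T) • ∫ t in Set.Icc (0 : ℝ) T, (∫ c, (∫ ε : EuclideanSpace ℝ (Fin D),
        (gaussPDF 0 1 ε * (w t * s t)) •
          ContinuousLinearMap.adjoint (fderiv ℝ (fun θ' => g θ' c) θ)
            (gradient (fun x => log (gaussPDF (a t • g θ c) (s t) x))
              (a t • g θ c + s t • ε))) ∂pc)
      = (0 : EuclideanSpace ℝ (Fin N))) := by
  have hcond : ∀ t ∈ Set.Icc (0 : ℝ) T, ∀ c : C, ∀ k : ℝ,
      ∫ ε, (gaussPDF 0 1 ε * k) • ContinuousLinearMap.adjoint (fderiv ℝ (fun θ' => g θ' c) θ)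
        (gradient (fun x => log (gaussPDF (a t • g θ c) (s t) x)) (a t • g θ c + s t • ε)) = 0 :=
    fun t ht c k => integral_gaussPDF_smul_gradient_log_gaussPDF _ _ (hs t ht).ne' k
  constructor
  · rw [hDUI, ← smul_neg, ← integral_neg]
    congr 1
    refine setIntegral_congr_fun measurableSet_Icc fun t ht => ?_
    rw [← integral_neg]
    refine integral_congr_ae (.of_forall fun c => ?_)
    have hlog : Differentiable ℝ (fun x => log (p t x)) :=
      ((hp_smooth t).differentiable (by simp)).log fun x => (hp_pos t x).ne'
    have hzero : ∫ ε, (gaussPDF 0 1 ε * w t) •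
        ContinuousLinearMap.adjoint (fderiv ℝ (fun θ' => g θ' c) θ)
          (s t • gradient (fun x => log (gaussPDF (a t • g θ c) (s t) x))
            (a t • g θ c + s t • ε)) = 0 := by
      simpa only [map_smul, smul_smul, mul_assoc] using hcond t ht c (w t * s t)
    simp only [gradient_log_gaussPDF_sub_log (hg c θ) (ha t ht).ne' (hs t ht).ne' (w t) _
      (hlog _), map_sub, smul_sub, smul_neg, smul_smul]
    rw [integral_sub (hInt_score t ht c) (hInt_cond t ht c), hzero, sub_zero, integral_neg]
  · rw [setIntegral_eq_zero_of_forall_eq_zero, smul_zero]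
    exact fun t ht => by simp only [hcond t ht, integral_zero]

end
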